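/- Let S_L = Σ_{i=1}^{𝓛} L_i and S_R = Σ_{j=1}^{ℛ} R_j, and set A* = { i : S_L − S_R ≤ L_i } and B* = { j : S_R − S_L ≤ R_j }. Then the minimum of E(A,B) over all markings (A,B) equals min( E(A*, ∅), E(∅, B*) ); that is, the better of the two markings (A*, ∅) and (∅, B*) (the output of the tree-compression algorithm for a single merged edge) is an optimal marking. -/

import Mathlib

open Finset in
/-- For a contracted edge `e*` in a weighted tree with `l` left and `r` right neighbouring
edges, where the subtree hanging off the `i`-th left (resp. `j`-th right) neighbouring edge
has `L i` (resp. `R j`) vertices, and a marking `(A, B)` of left/right neighbouring edges,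
the error (in units of `w*`) is
`E(A,B) = 2·Σ_{i<j ∈ A} L_i·L_j + 2·Σ_{i<j ∈ B} R_i·R_j + Σ_{i∈A, j∈B} L_i·R_j`
`  + Σ_{i∈A, i′∉A} L_i·L_{i′} + Σ_{j∈B, j′∉B} R_j·R_{j′} + Σ_{i∉A, j∉B} L_i·R_j`. -/
def markErr {l r : ℕ} (L : Fin l → ℕ) (R : Fin r → ℕ)
    (A : Finset (Fin l)) (B : Finset (Fin r)) : ℕ :=
  2 * (∑ i ∈ A, ∑ j ∈ A, if i < j then L i * L j else 0)
    + 2 * (∑ i ∈ B, ∑ j ∈ B, if i < j then R i * R j else 0)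
    + (∑ i ∈ A, ∑ j ∈ B, L i * R j)
    + (∑ i ∈ A, ∑ j ∈ Aᶜ, L i * L j)
    + (∑ i ∈ B, ∑ j ∈ Bᶜ, R i * R j)
    + (∑ i ∈ Aᶜ, ∑ j ∈ Bᶜ, L i * R j)

section

open Finset

theorem two_mul_sum_lt_add_sum_sq {n : ℕ} (f : Fin n → ℕ) (A : Finset (Fin n)) :
    2 * (∑ i ∈ A, ∑ j ∈ A, if i < j then f i * f j else 0) + ∑ i ∈ A, f i ^ 2
      = (∑ i ∈ A, f i) ^ 2 := by
  have hdiag : ∑ i ∈ A, f i ^ 2 = ∑ i ∈ A, ∑ j ∈ A, if i = j then f i * f j else 0 := by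
    refine sum_congr rfl fun i hi => ?_
    rw [sum_ite_eq, if_pos hi, sq]
  have hswap : (∑ i ∈ A, ∑ j ∈ A, if i < j then f i * f j else 0)
      = ∑ i ∈ A, ∑ j ∈ A, if j < i then f i * f j else 0 := by
    rw [sum_comm]
    simp only [mul_comm]
  rw [two_mul]
  nth_rewrite 2 [hswap]
  rw [hdiag, sq, sum_mul_sum]
  simp only [← sum_add_distrib]
  refine sum_congr rfl fun i _ => sum_congr rfl fun j _ => ?_
  rcases lt_trichotomy i j with h | h | h
  · simp [h, h.not_gt, h.ne]
  · simp [h]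
  · simp [h, h.not_gt, h.ne']

/-- The error in closed form, with all sums over complements eliminated. -/
theorem markErr_eq {l r : ℕ} (L : Fin l → ℕ) (R : Fin r → ℕ)
    (A : Finset (Fin l)) (B : Finset (Fin r)) :
    (markErr L R A B : ℤ) = (∑ i, (L i : ℤ)) * (∑ j, (R j : ℤ))
      + (∑ i ∈ A, (L i : ℤ)) * ((∑ i, (L i : ℤ)) - ∑ j, (R j : ℤ)) - ∑ i ∈ A, (L i : ℤ) ^ 2
      + (∑ j ∈ B, (R j : ℤ)) * ((∑ j, (R j : ℤ)) - ∑ i, (L i : ℤ)) - ∑ j ∈ B, (R j : ℤ) ^ 2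
      + 2 * (∑ i ∈ A, (L i : ℤ)) * ∑ j ∈ B, (R j : ℤ) := by
  have hA := congrArg (Nat.cast : ℕ → ℤ) (two_mul_sum_lt_add_sum_sq L A)
  have hB := congrArg (Nat.cast : ℕ → ℤ) (two_mul_sum_lt_add_sum_sq R B)
  have hL := sum_add_sum_compl A fun i => (L i : ℤ)
  have hR := sum_add_sum_compl B fun j => (R j : ℤ)
  unfold markErr
  simp only [← sum_mul_sum]
  push_cast at hA hB ⊢
  rw [← hL, ← hR]
  linear_combination hA + hB

theorem sum_filter_nonpos_le_sum {ι : Type*} [Fintype ι] [DecidableEq ι] (t : ι → ℤ)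
    (p : ι → Prop) [DecidablePred p] (hp : ∀ i, p i → t i ≤ 0) (hn : ∀ i, ¬ p i → 0 ≤ t i)
    (A : Finset ι) : ∑ i with p i, t i ≤ ∑ i ∈ A, t i := by
  have hA : ∑ i ∈ A, t i = ∑ i, if i ∈ A then t i else 0 := by simp
  rw [sum_filter, hA]
  refine sum_le_sum fun i _ => ?_
  have := hp i
  have := hn i
  split_ifs <;> simp_all

theorem markErr_empty_right_le {l r : ℕ} (L : Fin l → ℕ) (R : Fin r → ℕ) (A : Finset (Fin l)) :
    markErr L R (univ.filter
      (fun i => (∑ i', (L i' : ℤ)) - (∑ j', (R j' : ℤ)) ≤ (L i : ℤ))) ∅ ≤ markErr L R A ∅ := by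
  have h := sum_filter_nonpos_le_sum
    (fun i => (L i : ℤ) * ((∑ i', (L i' : ℤ)) - (∑ j', (R j' : ℤ))) - (L i : ℤ) ^ 2)
    (fun i => (∑ i', (L i' : ℤ)) - (∑ j', (R j' : ℤ)) ≤ (L i : ℤ))
    (fun i hi => by nlinarith) (fun i hi => by nlinarith) A
  simp only [sum_sub_distrib, ← sum_mul] at h
  zify
  rw [markErr_eq, markErr_eq]
  simp only [sum_empty]
  linarith

theorem markErr_comm {l r : ℕ} (L : Fin l → ℕ) (R : Fin r → ℕ)
    (A : Finset (Fin l)) (B : Finset (Fin r)) : markErr L R A B = markErr R L B A := by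
  zify
  rw [markErr_eq, markErr_eq]
  ring

/-- Unmarking one whole side never increases the error, for a suitable choice of side. -/
theorem min_markErr_empty_le {l r : ℕ} (L : Fin l → ℕ) (R : Fin r → ℕ)
    (A : Finset (Fin l)) (B : Finset (Fin r)) :
    min (markErr L R A ∅) (markErr L R ∅ B) ≤ markErr L R A B := by
  have hA : ∑ i ∈ A, (L i : ℤ) ^ 2 ≤ (∑ i ∈ A, (L i : ℤ)) ^ 2 :=
    mod_cast (two_mul_sum_lt_add_sum_sq L A).le.trans' (Nat.le_add_left _ _)
  have hB : ∑ j ∈ B, (R j : ℤ) ^ 2 ≤ (∑ j ∈ B, (R j : ℤ)) ^ 2 :=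
    mod_cast (two_mul_sum_lt_add_sum_sq R B).le.trans' (Nat.le_add_left _ _)
  have ha : 0 ≤ ∑ i ∈ A, (L i : ℤ) := by positivity
  have hb : 0 ≤ ∑ j ∈ B, (R j : ℤ) := by positivity
  rw [min_le_iff]
  zify
  simp only [markErr_eq, sum_empty]
  generalize ∑ i ∈ A, (L i : ℤ) = a at *
  generalize ∑ j ∈ B, (R j : ℤ) = b at *
  generalize ∑ i, (L i : ℤ) = s at *
  generalize ∑ j, (R j : ℤ) = t at *
  rcases le_total 0 (2 * a - (s - t) - b) with h | h
  · left
    nlinarith [mul_nonneg hb h]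
  · right
    have h' : 0 ≤ 2 * b + (s - t) - a := by linarith
    nlinarith [mul_nonneg ha h']

end

/-- With `S_L = Σ_i L_i`, `S_R = Σ_j R_j`, `A* = {i : S_L − S_R ≤ L_i}` and
`B* = {j : S_R − S_L ≤ R_j}`, the better of the two markings `(A*, ∅)` and `(∅, B*)`
(the output of the tree-compression algorithm for a single merged edge) achieves the
minimum of `E(A,B)` over all markings `(A,B)`. -/
theorem tree_compression_algorithm_optimal (l r : ℕ) (hl : 1 ≤ l) (hr : 1 ≤ r)
    (L : Fin l → ℕ) (R : Fin r → ℕ) (hL : ∀ i, 1 ≤ L i) (hR : ∀ j, 1 ≤ R j) :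
    IsLeast {x : ℕ | ∃ (A : Finset (Fin l)) (B : Finset (Fin r)), x = markErr L R A B}
      (min
        (markErr L R (Finset.univ.filter
            (fun i => (∑ i', (L i' : ℤ)) - (∑ j', (R j' : ℤ)) ≤ (L i : ℤ))) ∅)
        (markErr L R ∅ (Finset.univ.filter
            (fun j => (∑ j', (R j' : ℤ)) - (∑ i', (L i' : ℤ)) ≤ (R j : ℤ))))) := by
  constructor
  · rcases min_choice
      (markErr L R (Finset.univ.filter
        (fun i => (∑ i', (L i' : ℤ)) - (∑ j', (R j' : ℤ)) ≤ (L i : ℤ))) ∅)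
      (markErr L R ∅ (Finset.univ.filter
        (fun j => (∑ j', (R j' : ℤ)) - (∑ i', (L i' : ℤ)) ≤ (R j : ℤ)))) with h | h
    · exact ⟨_, _, h⟩
    · exact ⟨_, _, h⟩
  · rintro _ ⟨A, B, rfl⟩
    refine (min_le_min (markErr_empty_right_le L R A) ?_).trans (min_markErr_empty_le L R A B)
    rw [markErr_comm L R, markErr_comm L R]
    exact markErr_empty_right_le R L B
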